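/- Let φ_w(t) = 2(1−|t|)³ · 1_{[1/2,1]}(|t|) + (6|t|³ − 6t² + 1) · 1_{[−1/2,1/2]}(t). Then for every real x ≠ 0, the inverse Fourier transform of φ_w satisfies (1/2π) ∫_{-∞}^{∞} e^{-itx} φ_w(t) dt = (3/(8π)) · (sin(x/4)/(x/4))⁴. -/

import Mathlib

open MeasureTheory

/-- The Fourier transform of the kernel of Wand:
`φ_w(t) = 2(1−|t|)³ 1_{[1/2,1]}(|t|) + (6|t|³ − 6t² + 1) 1_{[−1/2,1/2]}(t)`. -/
noncomputable def phiWand (t : ℝ) : ℝ :=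
  (if |t| ∈ Set.Icc (1/2 : ℝ) 1 then 2 * (1 - |t|) ^ 3 else 0)
    + (if t ∈ Set.Icc (-(1/2) : ℝ) (1/2) then 6 * |t| ^ 3 - 6 * t ^ 2 + 1 else 0)

theorem integral_exp_mul_sub_pow_three {c : ℂ} (hc : c ≠ 0) (a : ℝ) :
    ∫ t in (0 : ℝ)..a, Complex.exp (c * t) * ((a : ℂ) - t) ^ 3
      = 6 * Complex.exp (c * a) / c ^ 4
        - (a ^ 3 / c + 3 * a ^ 2 / c ^ 2 + 6 * a / c ^ 3 + 6 / c ^ 4) := by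
  have hderiv : ∀ t ∈ Set.uIcc 0 a, HasDerivAt
      (fun t : ℝ ↦ Complex.exp (c * t) * (((a : ℂ) - t) ^ 3 / c + 3 * ((a : ℂ) - t) ^ 2 / c ^ 2
        + 6 * ((a : ℂ) - t) / c ^ 3 + 6 / c ^ 4))
      (Complex.exp (c * t) * ((a : ℂ) - t) ^ 3) t := by
    intro t _
    have hid : HasDerivAt (fun t : ℝ ↦ (t : ℂ)) 1 t := Complex.ofRealCLM.hasDerivAt
    have hsub := hid.const_sub (a : ℂ)
    have h := (hid.const_mul c).cexp.mul
      (((((hsub.pow 3).div_const c).add (((hsub.pow 2).const_mul 3).div_const (c ^ 2))).add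
        ((hsub.const_mul 6).div_const (c ^ 3))).add_const (6 / c ^ 4))
    refine h.congr_deriv ?_
    simp only [Pi.add_apply, Pi.pow_apply]
    push_cast
    field_simp
    ring
  rw [intervalIntegral.integral_eq_sub_of_hasDerivAt hderiv
    (Continuous.intervalIntegrable (by fun_prop) _ _)]
  simp
  ring

/-- The truncated power `(a - |t|)³` on `[-a, a]`, extended by zero, times `exp (c t)`. -/
noncomputable def expMulTruncatedCube (c : ℂ) (a : ℝ) : ℝ → ℂ :=
  (Set.Icc (-a) a).indicator fun t ↦ Complex.exp (c * t) * (((a - |t|) ^ 3 : ℝ) : ℂ)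

theorem integrable_expMulTruncatedCube (c : ℂ) (a : ℝ) :
    Integrable (expMulTruncatedCube c a) :=
  (integrable_indicator_iff measurableSet_Icc).2
    (Continuous.integrableOn_Icc (by fun_prop))

theorem integral_expMulTruncatedCube {c : ℂ} (hc : c ≠ 0) {a : ℝ} (ha : 0 ≤ a) :
    ∫ t, expMulTruncatedCube c a t
      = 6 * (Complex.exp (c * a) + Complex.exp (-(c * a))) / c ^ 4
        - 6 * a ^ 2 / c ^ 2 - 12 / c ^ 4 := by
  have hcont : Continuous fun t : ℝ ↦ Complex.exp (c * t) * (((a - |t|) ^ 3 : ℝ) : ℂ) := by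
    fun_prop
  have hpos : ∫ t in (0 : ℝ)..a, Complex.exp (c * t) * (((a - |t|) ^ 3 : ℝ) : ℂ)
      = ∫ t in (0 : ℝ)..a, Complex.exp (c * t) * ((a : ℂ) - t) ^ 3 := by
    refine intervalIntegral.integral_congr fun t ht ↦ ?_
    rw [Set.uIcc_of_le ha] at ht
    simp [abs_of_nonneg ht.1]
  have hneg : ∫ t in (-a)..(0 : ℝ), Complex.exp (c * t) * (((a - |t|) ^ 3 : ℝ) : ℂ)
      = ∫ t in (0 : ℝ)..a, Complex.exp (-c * t) * ((a : ℂ) - t) ^ 3 := by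
    rw [← neg_zero, ← intervalIntegral.integral_comp_neg, neg_zero]
    refine intervalIntegral.integral_congr fun t ht ↦ ?_
    rw [Set.uIcc_of_le ha] at ht
    simp [abs_of_nonneg ht.1]
  rw [expMulTruncatedCube, integral_indicator measurableSet_Icc, integral_Icc_eq_integral_Ioc,
    ← intervalIntegral.integral_of_le (by linarith),
    ← intervalIntegral.integral_add_adjacent_intervals (hcont.intervalIntegrable (-a) 0)
      (hcont.intervalIntegrable 0 a), hpos, hneg, integral_exp_mul_sub_pow_three hc,
    integral_exp_mul_sub_pow_three (neg_ne_zero.2 hc), neg_mul]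
  field_simp
  ring

theorem phiWand_eq_of_abs_ne {t : ℝ} (ht : |t| ≠ 1 / 2) :
    phiWand t = 2 * (if t ∈ Set.Icc (-1 : ℝ) 1 then (1 - |t|) ^ 3 else 0)
      - 8 * (if t ∈ Set.Icc (-(1 / 2) : ℝ) (1 / 2) then (1 / 2 - |t|) ^ 3 else 0) := by
  simp only [phiWand, Set.mem_Icc, ← abs_le]
  rcases lt_or_gt_of_ne ht with h | h
  · rw [if_neg (by rintro ⟨h', -⟩; linarith), if_pos h.le, if_pos (by linarith), if_pos h.le,
      ← sq_abs t]
    ring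
  · by_cases h1 : |t| ≤ 1
    · rw [if_pos ⟨h.le, h1⟩, if_neg h.not_ge, if_pos h1, if_neg h.not_ge]
      ring
    · rw [if_neg (fun h' ↦ h1 h'.2), if_neg h.not_ge, if_neg h1, if_neg h.not_ge]
      ring

theorem exp_mul_phiWand_ae_eq (c : ℂ) :
    (fun t : ℝ ↦ Complex.exp (c * t) * (phiWand t : ℂ)) =ᵐ[volume]
      fun t ↦ 2 * expMulTruncatedCube c 1 t - 8 * expMulTruncatedCube c (1 / 2) t := by
  filter_upwards [Measure.ae_ne volume (1 / 2 : ℝ), Measure.ae_ne volume (-(1 / 2) : ℝ)]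
    with t h₁ h₂
  rw [phiWand_eq_of_abs_ne fun h ↦ (eq_or_eq_neg_of_abs_eq h).elim h₁ h₂]
  simp only [expMulTruncatedCube, Set.indicator_apply]
  split_ifs <;> push_cast <;> ring

/-- The inverse Fourier transform of `φ_w` is `w(x) = (3/(8π)) (sin(x/4)/(x/4))⁴`
for `x ≠ 0`. -/
theorem invFourier_wandKernel (x : ℝ) (hx : x ≠ 0) :
    (2 * Real.pi : ℂ)⁻¹ * ∫ t : ℝ, Complex.exp (-(Complex.I * t * x)) * (phiWand t : ℂ)
      = ((3 / (8 * Real.pi) * (Real.sin (x / 4) / (x / 4)) ^ 4 : ℝ) : ℂ) := by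
  have hx' : (x : ℂ) ≠ 0 := by exact_mod_cast hx
  have hpi : (Real.pi : ℂ) ≠ 0 := by exact_mod_cast Real.pi_ne_zero
  have hc : -(Complex.I * x) ≠ 0 := neg_ne_zero.2 (mul_ne_zero Complex.I_ne_zero hx')
  have hrw : ∀ t : ℝ, -(Complex.I * t * x) = -(Complex.I * x) * t := fun t ↦ by ring
  simp only [hrw]
  rw [integral_congr_ae (exp_mul_phiWand_ae_eq _),
    integral_sub ((integrable_expMulTruncatedCube _ _).const_mul _)
      ((integrable_expMulTruncatedCube _ _).const_mul _),
    integral_const_mul, integral_const_mul, integral_expMulTruncatedCube hc zero_le_one,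
    integral_expMulTruncatedCube hc (by norm_num)]
  push_cast
  rw [Complex.sin]
  set u := Complex.exp (-(x / 4) * Complex.I) with hu
  set v := Complex.exp (x / 4 * Complex.I) with hv
  have huv : u * v = 1 := by rw [hu, hv, ← Complex.exp_add]; simp
  have h₁ : Complex.exp (-(Complex.I * x) * 1) = u ^ 4 := by
    rw [hu, ← Complex.exp_nat_mul]; congr 1; push_cast; ring
  have h₂ : Complex.exp (-(-(Complex.I * x) * 1)) = v ^ 4 := by
    rw [hv, ← Complex.exp_nat_mul]; congr 1; push_cast; ring
  have h₃ : Complex.exp (-(Complex.I * x) * (1 / 2)) = u ^ 2 := by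
    rw [hu, ← Complex.exp_nat_mul]; congr 1; push_cast; ring
  have h₄ : Complex.exp (-(-(Complex.I * x) * (1 / 2))) = v ^ 2 := by
    rw [hv, ← Complex.exp_nat_mul]; congr 1; push_cast; ring
  rw [h₁, h₂, h₃, h₄]
  have hI4 : (-(Complex.I * (x : ℂ))) ^ 4 = x ^ 4 := by
    rw [neg_pow, mul_pow, Complex.I_pow_four]; ring
  have hI2 : (-(Complex.I * (x : ℂ))) ^ 2 = -x ^ 2 := by
    rw [neg_sq, mul_pow, Complex.I_sq]; ring
  have hpow : (u - v) ^ 4 = u ^ 4 + v ^ 4 - 4 * (u ^ 2 + v ^ 2) + 6 := by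
    linear_combination (-4 * u ^ 2 - 4 * v ^ 2 + 6 * (u * v + 1)) * huv
  rw [hI4, hI2, div_pow _ ((x : ℂ) / 4), div_pow (_ * _) (2 : ℂ), mul_pow (u - v), Complex.I_pow_four, hpow]
  field_simp
  ring
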